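/- arXiv:1302.4539 — 9 statements merged into one kernel-verified Lean document; each statement's English description precedes it below -/
import Mathlib

section
/- Let R and W be relations on a set Q. Then lfp(λY. R ∪ g(Y)) ⊆ W if and only if R ⊆ gfp(λY. W ∩ g̃(Y)), where g(Y) = Y ∘ R and g̃(Y) = ¬(¬Y ∘ R⁻¹). -/
/-- Composition of relations viewed as subsets of `Q × Q`:
`relComp X R = {(s,s') | ∃ s₁, (s,s₁) ∈ X ∧ (s₁,s') ∈ R}`. -/
def relComp {Q : Type*} (X R : Set (Q × Q)) : Set (Q × Q) :=
  {p | ∃ s₁, (p.1, s₁) ∈ X ∧ (s₁, p.2) ∈ R}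

/-- Inverse of a relation: `relInv R = {(s',s) | (s,s') ∈ R}`. -/
def relInv {Q : Type*} (R : Set (Q × Q)) : Set (Q × Q) :=
  {p | (p.2, p.1) ∈ R}

/-- `gtilde R Y = ¬(¬Y ∘ R⁻¹)`. -/
def gtilde {Q : Type*} (R Y : Set (Q × Q)) : Set (Q × Q) :=
  (relComp Yᶜ (relInv R))ᶜ

theorem relComp_mono {Q : Type*} {X X' : Set (Q × Q)} (R : Set (Q × Q)) (h : X ⊆ X') :
    relComp X R ⊆ relComp X' R := fun _ ⟨s₁, h1, h2⟩ => ⟨s₁, h h1, h2⟩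

/-- The monotone map `Y ↦ S ∪ (Y ∘ R)`. -/
def fwd {Q : Type*} (R S : Set (Q × Q)) : Set (Q × Q) →o Set (Q × Q) :=
  ⟨fun Y => S ∪ relComp Y R,
   fun _ _ h => Set.union_subset_union subset_rfl (relComp_mono R h)⟩

/-- The monotone map `Y ↦ W ∩ ¬(¬Y ∘ R⁻¹)`. -/
def bwd {Q : Type*} (R W : Set (Q × Q)) : Set (Q × Q) →o Set (Q × Q) :=
  ⟨fun Y => W ∩ gtilde R Y,
   fun _ _ h => Set.inter_subset_inter subset_rfl
     (Set.compl_subset_compl.2 (relComp_mono (relInv R) (Set.compl_subset_compl.2 h)))⟩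

/-- Transitive closure of a relation viewed as a subset of `Q × Q`. -/
def transClos {Q : Type*} (R : Set (Q × Q)) : Set (Q × Q) :=
  {p | Relation.TransGen (fun a b => (a, b) ∈ R) p.1 p.2}

/-- Reflexive-transitive closure of a relation viewed as a subset of `Q × Q`. -/
def reflTransClos {Q : Type*} (R : Set (Q × Q)) : Set (Q × Q) :=
  {p | Relation.ReflTransGen (fun a b => (a, b) ∈ R) p.1 p.2}


/-- Right composition with `R` is left adjoint to `gtilde R`. -/
theorem relComp_subset_iff_subset_gtilde {Q : Type*} {R X Y : Set (Q × Q)} :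
    relComp X R ⊆ Y ↔ X ⊆ gtilde R Y := by
  constructor
  · rintro h ⟨s, s'⟩ hX ⟨t, hY, hR⟩
    exact hY (h ⟨s', hX, hR⟩)
  · rintro h ⟨s, t⟩ ⟨s', hX, hR⟩
    by_contra hY
    exact h hX ⟨t, hY, hR⟩

/-- lfp (λ Y. R ∪ g Y) ⊆ W iff R ⊆ gfp (λ Y. W ∩ g̃ Y). -/
theorem stmt2 {Q : Type*} (R W : Set (Q × Q)) :
    OrderHom.lfp (fwd R R) ⊆ W ↔ R ⊆ OrderHom.gfp (bwd R W) := by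
  constructor
  · intro h
    have hfix : R ∪ relComp (fwd R R).lfp R ⊆ (fwd R R).lfp := (fwd R R).map_lfp.le
    have hL : (fwd R R).lfp ⊆ (bwd R W).gfp := (bwd R W).le_gfp <|
      Set.subset_inter h <|
        relComp_subset_iff_subset_gtilde.1 (Set.subset_union_right.trans hfix)
    exact (Set.subset_union_left.trans hfix).trans hL
  · intro h
    have hfix : (bwd R W).gfp ⊆ W ∩ gtilde R (bwd R W).gfp := (bwd R W).map_gfp.ge
    have hL : (fwd R R).lfp ⊆ (bwd R W).gfp := (fwd R R).lfp_le <|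
      Set.union_subset h <|
        relComp_subset_iff_subset_gtilde.2 (hfix.trans Set.inter_subset_right)
    exact hL.trans (hfix.trans Set.inter_subset_left)
end

section
/- Let R and W be relations on a set Q, let G = gfp(λY. W ∩ g̃(Y)) where g̃(Y) = ¬(¬Y ∘ R⁻¹), and let R_good = R ∩ G. Then lfp(λY. R_good ∪ (Y ∘ R)) ⊆ W. -/
theorem subset_gtilde_iff {Q : Type*} (R Y Z : Set (Q × Q)) :
    Y ⊆ gtilde R Z ↔ relComp Y R ⊆ Z := by
  constructor
  · rintro h ⟨s, s'⟩ ⟨s₁, hY, hR⟩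
    by_contra hZ
    exact h hY ⟨s', hZ, hR⟩
  · rintro h ⟨s, s₁⟩ hY ⟨s', hZ, hR⟩
    exact hZ (h ⟨s₁, hY, hR⟩)

/-- with G = gfp (λ Y. W ∩ g̃ Y) and R_good = R ∩ G,
lfp (λ Y. R_good ∪ (Y ∘ R)) ⊆ W. -/
theorem stmt5 {Q : Type*} (R W : Set (Q × Q)) :
    OrderHom.lfp (fwd R (R ∩ OrderHom.gfp (bwd R W))) ⊆ W := by
  have hG : OrderHom.gfp (bwd R W) ⊆ W ∩ gtilde R (OrderHom.gfp (bwd R W)) :=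
    (OrderHom.map_gfp (bwd R W)).ge
  obtain ⟨hW, hg⟩ := Set.subset_inter_iff.1 hG
  exact (OrderHom.lfp_le _ (Set.union_subset Set.inter_subset_right
    ((subset_gtilde_iff R _ _).1 hg))).trans hW
end

section
/- Let R and W be relations on a set Q, let G = gfp(λY. W ∩ g̃(Y)) where g̃(Y) = ¬(¬Y ∘ R⁻¹), and let R_good = R ∩ G. Then R_good ∘ R* ⊆ W, where R* denotes the reflexive-transitive closure of R. -/
theorem gfp_bwd_subset {Q : Type*} (R W : Set (Q × Q)) : OrderHom.gfp (bwd R W) ⊆ W :=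
  fun _ hp => ((bwd R W).map_gfp.ge hp).1

theorem mem_gfp_bwd_of_step {Q : Type*} {R W : Set (Q × Q)} {s a b : Q}
    (h : (s, a) ∈ OrderHom.gfp (bwd R W)) (hab : (a, b) ∈ R) :
    (s, b) ∈ OrderHom.gfp (bwd R W) :=
  by_contra fun hb => ((bwd R W).map_gfp.ge h).2 ⟨b, hb, hab⟩

/-- with G = gfp (λ Y. W ∩ g̃ Y) and R_good = R ∩ G, R_good ∘ R* ⊆ W. -/
theorem stmt7 {Q : Type*} (R W : Set (Q × Q)) :
    relComp (R ∩ OrderHom.gfp (bwd R W)) (reflTransClos R) ⊆ W := by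
  rintro ⟨s, t⟩ ⟨a, ⟨-, ha⟩, hat⟩
  apply gfp_bwd_subset R W
  change (s, a) ∈ _ at ha
  change Relation.ReflTransGen _ a t at hat
  induction hat with
  | refl => exact ha
  | tail _ hbc ih => exact mem_gfp_bwd_of_step ih hbc
end

section
/- Let R be a relation on a set Q and let W = W₁ ∪ … ∪ Wₙ be a disjunctively well-founded relation on Q. Let G = gfp(λY. W ∩ g̃(Y)) where g̃(Y) = ¬(¬Y ∘ R⁻¹), and let R_bad = R \ G. Then every infinite R-trace has a suffix that is an infinite R_bad-trace: for every sequence s : ℕ → Q with (s(i), s(i+1)) ∈ R for all i, there exists N such that (s(i), s(i+1)) ∈ R_bad for all i ≥ N. -/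
/-- If all forward pairs of a sequence are covered by finitely many relations, then one of these
relations has an infinite trace. -/
theorem exists_trace_of_forall_lt_mem {Q : Type*} (n : ℕ) (Ws : Fin n → Set (Q × Q)) (t : ℕ → Q)
    (ht : ∀ i j, i < j → ∃ c, (t i, t j) ∈ Ws c) :
    ∃ c, ∃ u : ℕ → Q, ∀ k, (u k, u (k + 1)) ∈ Ws c := by
  induction n generalizing t with
  | zero => exact (ht 0 1 one_pos).choose.elim0
  | succ n ih =>
    obtain ⟨g, hg | hg⟩ :=
      exists_increasing_or_nonincreasing_subseq' (fun a b => (a, b) ∈ Ws 0) t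
    · exact ⟨0, fun k => t (g k), hg⟩
    · obtain ⟨c, hc⟩ := ih (fun i => Ws i.succ) (fun k => t (g k)) fun i j hij => by
        obtain ⟨c, hc⟩ := ht (g i) (g j) (g.strictMono hij)
        induction c using Fin.cases with
        | zero => exact absurd hc (hg i j hij)
        | succ c => exact ⟨c, hc⟩
      exact ⟨c.succ, hc⟩

theorem mem_gfp_bwd_succ {Q : Type*} {R W : Set (Q × Q)} {a b c : Q}
    (h : (a, b) ∈ OrderHom.gfp (bwd R W)) (hbc : (b, c) ∈ R) :
    (a, c) ∈ OrderHom.gfp (bwd R W) := by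
  rw [← OrderHom.map_gfp] at h
  by_contra hac
  exact h.2 ⟨c, hac, hbc⟩

/-- Along an `R`-trace, a step in the greatest fixpoint relates its source to all later states. -/
theorem mem_gfp_bwd_of_lt {Q : Type*} {R W : Set (Q × Q)} {s : ℕ → Q}
    (hs : ∀ k, (s k, s (k + 1)) ∈ R) {i j : ℕ}
    (hi : (s i, s (i + 1)) ∈ OrderHom.gfp (bwd R W)) (hij : i < j) :
    (s i, s j) ∈ OrderHom.gfp (bwd R W) := by
  induction j, hij using Nat.le_induction with
  | base => exact hi
  | succ j _ ih => exact mem_gfp_bwd_succ ih (hs j)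

/-- if W = W₁ ∪ ... ∪ Wₙ is disjunctively well-founded,
G = gfp (λ Y. W ∩ g̃ Y) and R_bad = R \ G, then every infinite R-trace has a suffix
that is an infinite R_bad-trace. -/
theorem stmt10 {Q : Type*} (R W : Set (Q × Q)) (n : ℕ) (Ws : Fin n → Set (Q × Q))
    (hW : W = ⋃ i, Ws i)
    (hwf : ∀ i, ¬∃ s : ℕ → Q, ∀ k, (s k, s (k + 1)) ∈ Ws i)
    (s : ℕ → Q) (hs : ∀ k, (s k, s (k + 1)) ∈ R) :
    ∃ N, ∀ k ≥ N, (s k, s (k + 1)) ∈ R \ OrderHom.gfp (bwd R W) := by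
  by_contra! h
  obtain ⟨φ, hφ, hG⟩ := Filter.extraction_of_frequently_atTop
    (P := fun k => (s k, s (k + 1)) ∈ OrderHom.gfp (bwd R W)) <|
    Filter.frequently_atTop.2 fun N => by
      obtain ⟨k, hk, hk'⟩ := h N
      exact ⟨k, hk, by_contra fun hn => hk' ⟨hs k, hn⟩⟩
  obtain ⟨c, hc⟩ := exists_trace_of_forall_lt_mem n Ws (fun k => s (φ k)) fun i j hij => by
    have hmem := gfp_bwd_subset R W (mem_gfp_bwd_of_lt hs (hG i) (hφ hij))
    rwa [hW, Set.mem_iUnion] at hmem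
  exact hwf c hc
end

section
/- Let R and W be relations on a set Q and let G' be any relation with G' ⊆ gfp(λY. W ∩ g̃(Y)), where g̃(Y) = ¬(¬Y ∘ R⁻¹). Then lfp(λY. (R ∩ G') ∪ (Y ∘ R)) ⊆ W. -/
theorem mem_gtilde {Q : Type*} {R Y : Set (Q × Q)} {p : Q × Q} :
    p ∈ gtilde R Y ↔ ∀ s₁, (p.2, s₁) ∈ R → (p.1, s₁) ∈ Y := by
  simp only [gtilde, relComp, relInv, Set.mem_compl_iff, Set.mem_ofPred_eq, not_exists, not_and]
  exact forall_congr' fun _ => not_imp_not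

/-- if G' ⊆ gfp (λ Y. W ∩ g̃ Y) then lfp (λ Y. (R ∩ G') ∪ (Y ∘ R)) ⊆ W. -/
theorem stmt11 {Q : Type*} (R W G' : Set (Q × Q))
    (hG : G' ⊆ OrderHom.gfp (bwd R W)) :
    OrderHom.lfp (fwd R (R ∩ G')) ⊆ W := by
  have hfix : OrderHom.gfp (bwd R W) ⊆ W ∩ gtilde R (OrderHom.gfp (bwd R W)) :=
    (OrderHom.map_gfp (bwd R W)).ge
  have hle : OrderHom.lfp (fwd R (R ∩ G')) ⊆ OrderHom.gfp (bwd R W) :=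
    OrderHom.lfp_le _ (Set.union_subset (Set.inter_subset_right.trans hG)
      (relComp_subset_iff_subset_gtilde.2 (hfix.trans Set.inter_subset_right)))
  exact hle.trans (hfix.trans Set.inter_subset_left)
end

section
/- Let R be a relation on a set Q, let W = W₁ ∪ … ∪ Wₙ be a disjunctively well-founded relation on Q, and let G' be any relation with G' ⊆ gfp(λY. W ∩ g̃(Y)), where g̃(Y) = ¬(¬Y ∘ R⁻¹). Let R_bad = R \ G'. Then every infinite R-trace has a suffix that is an infinite R_bad-trace: for every sequence s : ℕ → Q with (s(i), s(i+1)) ∈ R for all i, there exists N such that (s(i), s(i+1)) ∈ R_bad for all i ≥ N. -/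
/-- Ramsey argument: no sequence has all its increasing pairs covered by finitely many
well-founded relations. -/
theorem not_forall_lt_exists_mem_of_wellFounded {Q : Type*} (n : ℕ) (Ws : Fin n → Set (Q × Q))
    (hwf : ∀ i, ¬∃ s : ℕ → Q, ∀ k, (s k, s (k + 1)) ∈ Ws i) (t : ℕ → Q) :
    ¬∀ i j, i < j → ∃ c, (t i, t j) ∈ Ws c := by
  induction n generalizing t with
  | zero =>
    intro h
    obtain ⟨c, -⟩ := h 0 1 one_pos
    exact c.elim0
  | succ n ih =>
    intro h
    obtain ⟨g, hg | hg⟩ :=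
      exists_increasing_or_nonincreasing_subseq' (fun a b => (a, b) ∈ Ws 0) t
    · exact hwf 0 ⟨fun k => t (g k), hg⟩
    · refine ih (fun i => Ws i.succ) (fun i => hwf i.succ) (fun k => t (g k)) fun i j hij => ?_
      obtain ⟨c, hc⟩ := h (g i) (g j) (g.lt_iff_lt.2 hij)
      rcases Fin.eq_zero_or_eq_succ c with rfl | ⟨d, rfl⟩
      · exact absurd hc (hg i j hij)
      · exact ⟨d, hc⟩

theorem mem_gfp_bwd_of_mem {Q : Type*} {R W : Set (Q × Q)} {a b c : Q}
    (hab : (a, b) ∈ OrderHom.gfp (bwd R W)) (hbc : (b, c) ∈ R) :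
    (a, c) ∈ OrderHom.gfp (bwd R W) := by
  by_contra hac
  exact ((bwd R W).map_gfp.ge hab).2 ⟨c, hac, hbc⟩

/-- if W = W₁ ∪ ... ∪ Wₙ is disjunctively well-founded,
G' ⊆ gfp (λ Y. W ∩ g̃ Y) and R_bad = R \ G', then every infinite R-trace has a suffix
that is an infinite R_bad-trace. -/
theorem stmt12 {Q : Type*} (R W : Set (Q × Q)) (n : ℕ) (Ws : Fin n → Set (Q × Q))
    (hW : W = ⋃ i, Ws i)
    (hwf : ∀ i, ¬∃ s : ℕ → Q, ∀ k, (s k, s (k + 1)) ∈ Ws i)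
    (G' : Set (Q × Q)) (hG : G' ⊆ OrderHom.gfp (bwd R W))
    (s : ℕ → Q) (hs : ∀ k, (s k, s (k + 1)) ∈ R) :
    ∃ N, ∀ k ≥ N, (s k, s (k + 1)) ∈ R \ G' := by
  by_contra! hbad
  have hfreq : ∀ N, ∃ k > N, (s k, s (k + 1)) ∈ G' := fun N => by
    obtain ⟨k, hk, hmem⟩ := hbad (N + 1)
    exact ⟨k, hk, by_contra fun h => hmem ⟨hs k, h⟩⟩
  obtain ⟨φ, hφ, hφG⟩ := Nat.exists_strictMono_subsequence hfreq
  refine not_forall_lt_exists_mem_of_wellFounded n Ws hwf (fun i => s (φ i)) fun i j hij => ?_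
  have hmem : (s (φ i), s (φ j)) ∈ OrderHom.gfp (bwd R W) :=
    Nat.le_induction (m := φ i + 1)
      (P := fun m _ => (s (φ i), s m) ∈ OrderHom.gfp (bwd R W))
      (hG (hφG i)) (fun m _ hm => mem_gfp_bwd_of_mem hm (hs m)) (φ j) (hφ hij)
  simpa [hW] using gfp_bwd_subset R W hmem
end

section
/- Let R be a relation on a set Q and let W = W₁ ∪ … ∪ Wₙ be a disjunctively well-founded relation on Q. If R ⊆ gfp(λY. W ∩ g̃(Y)), where g̃(Y) = ¬(¬Y ∘ R⁻¹), then R is well-founded, i.e., there is no infinite R-trace. -/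
/-- A sequence whose forward pairs are all covered by finitely many relations has a subsequence
that is a trace of one of them. -/
theorem exists_trace_of_forward_pairs_covered {Q : Type*} :
    ∀ (n : ℕ) (Ws : Fin n → Set (Q × Q)) (s : ℕ → Q),
      (∀ a b, a < b → ∃ i, (s a, s b) ∈ Ws i) →
      ∃ i, ∃ t : ℕ → Q, ∀ k, (t k, t (k + 1)) ∈ Ws i
  | 0, _, _, h => (h 0 1 Nat.zero_lt_one).choose.elim0
  | n + 1, Ws, s, h => by
    obtain ⟨g, hg | hg⟩ :=
      exists_increasing_or_nonincreasing_subseq' (fun a b => (a, b) ∈ Ws 0) s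
    · exact ⟨0, fun k => s (g k), hg⟩
    · obtain ⟨i, t, ht⟩ := exists_trace_of_forward_pairs_covered n (fun i => Ws i.succ)
        (fun k => s (g k)) fun a b hab => by
          obtain ⟨i, hi⟩ := h _ _ (g.strictMono hab)
          rcases Fin.eq_zero_or_eq_succ i with rfl | ⟨j, rfl⟩
          · exact absurd hi (hg a b hab)
          · exact ⟨j, hi⟩
      exact ⟨i.succ, t, ht⟩

/-- If `R` is contained in the greatest fixpoint of `bwd R W`, so is its transitive closure;
stated for the forward pairs of an `R`-trace. -/
theorem trace_pair_mem_gfp_bwd {Q : Type*} {R W : Set (Q × Q)}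
    (hR : R ⊆ OrderHom.gfp (bwd R W)) {s : ℕ → Q} (hs : ∀ k, (s k, s (k + 1)) ∈ R)
    {a b : ℕ} (hab : a < b) : (s a, s b) ∈ OrderHom.gfp (bwd R W) := by
  induction b, hab using Nat.le_induction with
  | base => exact hR (hs a)
  | succ b _ ih =>
    rw [← OrderHom.map_gfp] at ih
    by_contra hnot
    exact ih.2 ⟨s (b + 1), hnot, hs b⟩

/-- if W = W₁ ∪ ... ∪ Wₙ is disjunctively well-founded and
R ⊆ gfp (λ Y. W ∩ g̃ Y), then R is well-founded (no infinite R-trace). -/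
theorem stmt13 {Q : Type*} (R W : Set (Q × Q)) (n : ℕ) (Ws : Fin n → Set (Q × Q))
    (hW : W = ⋃ i, Ws i)
    (hwf : ∀ i, ¬∃ s : ℕ → Q, ∀ k, (s k, s (k + 1)) ∈ Ws i)
    (hR : R ⊆ OrderHom.gfp (bwd R W)) :
    ¬∃ s : ℕ → Q, ∀ k, (s k, s (k + 1)) ∈ R := by
  rintro ⟨s, hs⟩
  obtain ⟨i, ht⟩ := exists_trace_of_forward_pairs_covered n Ws s fun a b hab => by
    have h := trace_pair_mem_gfp_bwd hR hs hab
    rw [← OrderHom.map_gfp] at h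
    have h_mem : (s a, s b) ∈ W := h.1
    rwa [hW, Set.mem_iUnion] at h_mem
  exact hwf i ht
end

section
/- Let R⁽⁰⁾, R⁽¹⁾, …, R⁽ᵏ⁾ be relations on a set Q such that for every 0 ≤ i < k there is a disjunctively well-founded relation W⁽ⁱ⁾ on Q and a relation G⁽ⁱ⁾ ⊆ gfp(λY. W⁽ⁱ⁾ ∩ ¬(¬Y ∘ (R⁽ⁱ⁾)⁻¹)) with R⁽ⁱ⁺¹⁾ = R⁽ⁱ⁾ \ G⁽ⁱ⁾. Then for every 0 ≤ i ≤ k, every infinite R⁽⁰⁾-trace has a suffix that is an infinite R⁽ⁱ⁾-trace: for every sequence s : ℕ → Q with (s(n), s(n+1)) ∈ R⁽⁰⁾ for all n, there exists N such that (s(n), s(n+1)) ∈ R⁽ⁱ⁾ for all n ≥ N. -/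
/-- If along an ultrafilter almost every pair is related by one of finitely many relations, then one
of these relations has an infinite trace. -/
theorem Ultrafilter.exists_trace_of_eventually_exists {ι α : Type*} [Finite ι]
    (P : ι → α → α → Prop) (l : Ultrafilter α) (h : ∀ᶠ a in l, ∀ᶠ b in l, ∃ j, P j a b) :
    ∃ j, ∃ f : ℕ → α, ∀ m, P j (f m) (f (m + 1)) := by
  simp only [Ultrafilter.eventually_exists_iff] at h
  obtain ⟨j, hj⟩ := h
  have step : ∀ a : {a // ∀ᶠ b in l, P j a b}, ∃ b : {a // ∀ᶠ b in l, P j a b}, P j a b := by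
    rintro ⟨a, ha⟩
    obtain ⟨b, hab, hb⟩ := (ha.and hj).exists
    exact ⟨⟨b, hb⟩, hab⟩
  choose next hnext using step
  obtain ⟨a, ha⟩ := hj.exists
  refine ⟨j, fun m => (next^[m] ⟨a, ha⟩ : {a // ∀ᶠ b in l, P j a b}), fun m => ?_⟩
  simp only [Function.iterate_succ_apply']
  exact hnext _

theorem mem_gfp_bwd_of_mem_s16 {Q : Type*} {R W : Set (Q × Q)} {x y z : Q}
    (hxy : (x, y) ∈ OrderHom.gfp (bwd R W)) (hyz : (y, z) ∈ R) :
    (x, z) ∈ OrderHom.gfp (bwd R W) := by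
  rw [← OrderHom.map_gfp] at hxy
  by_contra hxz
  exact hxy.2 ⟨z, hxz, hyz⟩

/-- Steps of a trace lying in the greatest fixpoint relate their source to all later states. -/
theorem mem_of_mem_gfp_bwd_of_trace {Q : Type*} {R W : Set (Q × Q)} {s : ℕ → Q} {N m : ℕ}
    (hs : ∀ n ≥ N, (s n, s (n + 1)) ∈ R) (hN : N ≤ m)
    (hm : (s m, s (m + 1)) ∈ OrderHom.gfp (bwd R W)) {n : ℕ} (hmn : m < n) :
    (s m, s n) ∈ W := by
  refine gfp_bwd_subset R W ?_
  induction n, hmn using Nat.le_induction with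
  | base => exact hm
  | succ n hn ih => exact mem_gfp_bwd_of_mem_s16 ih (hs n (by omega))

/-- A trace takes only finitely many steps in the greatest fixpoint for a disjunctively
well-founded relation. -/
theorem eventually_not_mem_gfp_bwd {Q ι : Type*} [Finite ι] {R : Set (Q × Q)}
    {Ws : ι → Set (Q × Q)} (hW : ∀ j, ¬∃ s : ℕ → Q, ∀ m, (s m, s (m + 1)) ∈ Ws j)
    {s : ℕ → Q} {N : ℕ} (hs : ∀ n ≥ N, (s n, s (n + 1)) ∈ R) :
    ∀ᶠ m in Filter.atTop, (s m, s (m + 1)) ∉ OrderHom.gfp (bwd R (⋃ j, Ws j)) := by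
  by_contra hfreq
  have : (Filter.atTop ⊓ Filter.principal
      {m | (s m, s (m + 1)) ∈ OrderHom.gfp (bwd R (⋃ j, Ws j))}).NeBot :=
    Filter.frequently_mem_iff_neBot.1 hfreq
  have hle := Ultrafilter.of_le (Filter.atTop ⊓ Filter.principal
    {m | (s m, s (m + 1)) ∈ OrderHom.gfp (bwd R (⋃ j, Ws j))})
  have htop := hle.trans inf_le_left
  obtain ⟨j, f, hf⟩ := Ultrafilter.exists_trace_of_eventually_exists
    (fun j a b => (s a, s b) ∈ Ws j) _ <| by
      filter_upwards [htop (Filter.eventually_ge_atTop N),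
        Filter.le_principal_iff.1 (hle.trans inf_le_right)] with a haN ha
      filter_upwards [htop (Filter.eventually_gt_atTop a)] with b hb
      exact Set.mem_iUnion.1 (mem_of_mem_gfp_bwd_of_trace hs haN ha hb)
  exact hW j ⟨s ∘ f, hf⟩

/-- if each R⁽ⁱ⁺¹⁾ = R⁽ⁱ⁾ \ G⁽ⁱ⁾ with
G⁽ⁱ⁾ ⊆ gfp (λ Y. W⁽ⁱ⁾ ∩ ¬(¬Y ∘ (R⁽ⁱ⁾)⁻¹)) for some disjunctively well-founded W⁽ⁱ⁾,
then for every i ≤ k, every infinite R⁽⁰⁾-trace has a suffix that is an infinite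
R⁽ⁱ⁾-trace. -/
theorem stmt16 {Q : Type*} (k : ℕ) (R : ℕ → Set (Q × Q))
    (h : ∀ i < k, ∃ (n : ℕ) (Ws : Fin n → Set (Q × Q)) (G : Set (Q × Q)),
      (∀ j, ¬∃ s : ℕ → Q, ∀ m, (s m, s (m + 1)) ∈ Ws j) ∧
      G ⊆ OrderHom.gfp (bwd (R i) (⋃ j, Ws j)) ∧
      R (i + 1) = R i \ G) :
    ∀ i ≤ k, ∀ s : ℕ → Q, (∀ m, (s m, s (m + 1)) ∈ R 0) →
      ∃ N, ∀ m ≥ N, (s m, s (m + 1)) ∈ R i := by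
  intro i hi s hs
  induction i with
  | zero => exact ⟨0, fun m _ => hs m⟩
  | succ i ih =>
    obtain ⟨N, hN⟩ := ih (by omega)
    obtain ⟨n, Ws, G, hW, hG, hR⟩ := h i hi
    refine Filter.eventually_atTop.1 ?_
    filter_upwards [eventually_not_mem_gfp_bwd hW hN, Filter.eventually_ge_atTop N] with m hm hNm
    rw [hR]
    exact ⟨hN m hNm, fun hmG => hm (hG hmG)⟩
end

section
/- The relation R on ℤ × ℤ defined by ((x,y),(x',y')) ∈ R iff x ≥ 1, x' = x + y, and y' = y − 1, is well-founded: there is no infinite sequence (x₀,y₀), (x₁,y₁), … with ((xᵢ,yᵢ),(xᵢ₊₁,yᵢ₊₁)) ∈ R for all i. -/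
/-- R = {((x,y),(x',y')) | x ≥ 1 ∧ x' = x + y ∧ y' = y - 1}. -/
def Rex : Set ((ℤ × ℤ) × (ℤ × ℤ)) :=
  {p | p.1.1 ≥ 1 ∧ p.2.1 = p.1.1 + p.1.2 ∧ p.2.2 = p.1.2 - 1}

theorem Rex.closed_form {s : ℕ → ℤ × ℤ} (hs : ∀ i, (s i, s (i + 1)) ∈ Rex) (n : ℕ) :
    (s n).2 = (s 0).2 - n ∧ 2 * (s n).1 = 2 * (s 0).1 + n * (2 * (s 0).2 - n + 1) := by
  induction n with
  | zero => simp
  | succ k ih =>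
    obtain ⟨-, hx, hy⟩ := hs k
    obtain ⟨ihy, ihx⟩ := ih
    dsimp only at hx hy
    push_cast
    constructor
    · linarith
    · rw [hx, mul_add, ihx, ihy]
      ring

/-- R is well-founded. -/
theorem stmt18 : ¬∃ s : ℕ → ℤ × ℤ, ∀ i, (s i, s (i + 1)) ∈ Rex := by
  rintro ⟨s, hs⟩
  set n : ℕ := 2 * (s 0).2.natAbs + 2 * (s 0).1.natAbs + 2 with hn
  have hpos : 1 ≤ (s n).1 := (hs n).1
  have hx := (Rex.closed_form hs n).2
  have hslope : 2 * (s 0).2 - n + 1 ≤ -(2 * ((s 0).1.natAbs : ℤ)) - 1 := by omega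
  have hn2 : (2 : ℤ) ≤ n := by omega
  have habs : (s 0).1 ≤ (s 0).1.natAbs := Int.le_natAbs
  nlinarith
end
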